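/- arXiv:2302.07311 — 5 statements merged into one kernel-verified Lean document; each statement's English description precedes it below -/
import Mathlib

section
/- Let μ be a singular cardinal with λ = cf(μ) < μ, let S be a nice system for μ, let D be a uniform ultrafilter on λ, and let θ be a regular cardinal with μ < θ ≤ 2^μ such that (1) Ch(D) ≤ θ and (2) there is a Sullam ⟨f_β : β<θ⟩ of length θ in (∏_{i<λ} W_i, D). Then there exists a uniform ultrafilter U on μ with Ch(U) ≤ θ; in particular 𝔲_μ ≤ θ. -/
universe u v

namespace PaperUlt

open Cardinal Set

/-- `F` is a (proper, nonprincipal-or-not) filter on the set of ordinals below `ν`. -/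
def IsFilterOn (ν : Ordinal.{u}) (F : Set (Set Ordinal.{u})) : Prop :=
  (∀ A ∈ F, A ⊆ Set.Iio ν) ∧
  Set.Iio ν ∈ F ∧
  (∅ : Set Ordinal.{u}) ∉ F ∧
  (∀ A ∈ F, ∀ B ∈ F, A ∩ B ∈ F) ∧
  (∀ A ∈ F, ∀ B, B ⊆ Set.Iio ν → A ⊆ B → B ∈ F)

/-- `U` is an ultrafilter on the ordinals below `ν`: a proper filter deciding every subset. -/
def IsUltrafilterOn (ν : Ordinal.{u}) (U : Set (Set Ordinal.{u})) : Prop :=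
  IsFilterOn ν U ∧ ∀ X, X ⊆ Set.Iio ν → (X ∈ U ∨ (Set.Iio ν \ X) ∈ U)

/-- A uniform filter on a cardinal `ν`: a filter containing every subset of `ν`
whose complement has cardinality `< ν`. -/
def IsUniformFilterOn (ν : Cardinal.{u}) (F : Set (Set Ordinal.{u})) : Prop :=
  IsFilterOn ν.ord F ∧
  ∀ X, X ⊆ Set.Iio ν.ord → #↥(Set.Iio ν.ord \ X) < Cardinal.lift.{u+1} ν → X ∈ F

/-- A uniform ultrafilter on a cardinal `ν`: every member has full cardinality `ν`. -/
def IsUniformUltrafilterOn (ν : Cardinal.{u}) (U : Set (Set Ordinal.{u})) : Prop :=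
  IsUltrafilterOn ν.ord U ∧ ∀ X ∈ U, #↥X = Cardinal.lift.{u+1} ν

/-- The `F`-positive sets. -/
def Pos (ν : Ordinal.{u}) (F : Set (Set Ordinal.{u})) : Set (Set Ordinal.{u}) :=
  {A | A ⊆ Set.Iio ν ∧ (Set.Iio ν \ A) ∉ F}

/-- `A ⊆_F B` : inclusion modulo the filter `F`. -/
def SubMod (F : Set (Set Ordinal.{u})) (A B : Set Ordinal.{u}) : Prop :=
  ∃ C ∈ F, A ∩ C ⊆ B

/-- A set of ordinals is bounded below `ν`. -/
def BoundedIn (ν : Ordinal.{u}) (A : Set Ordinal.{u}) : Prop :=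
  ∃ β < ν, A ⊆ Set.Iio β

/-- `b` is a base for `U` (a family of filter sets indexed by the ordinals `< c.ord`)
of cardinality (at most) `c`: every member of `U` almost contains some `b α`. -/
def IsBaseFam (ν : Cardinal.{u}) (U : Set (Set Ordinal.{u})) (c : Cardinal.{u})
    (b : Ordinal.{u} → Set Ordinal.{u}) : Prop :=
  (∀ α, α < c.ord → b α ∈ U) ∧ ∀ A ∈ U, ∃ α, α < c.ord ∧ BoundedIn ν.ord (b α \ A)

/-- `Ch ν U` : the least cardinality of a base for `U`. -/
noncomputable def Ch (ν : Cardinal.{u}) (U : Set (Set Ordinal.{u})) : Cardinal.{u} :=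
  sInf {c | ∃ b, IsBaseFam ν U c b}

/-- The ultrafilter number of `ν` : the minimum of `Ch ν U` over uniform ultrafilters `U`. -/
noncomputable def uNumber (ν : Cardinal.{u}) : Cardinal.{u} :=
  sInf {c | ∃ U, IsUniformUltrafilterOn ν U ∧ Ch ν U = c}

/-- A nice system for a singular cardinal `μ` of cofinality `lam`. -/
structure NiceSystem (μ lam : Cardinal.{u}) (W : Ordinal.{u} → Type v)
    [∀ i, Preorder (W i)] : Type (max (u+1) v) where
  lambda_ : Ordinal.{u} → Cardinal.{u}
  D : Ordinal.{u} → Set (Set Ordinal.{u})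
  g : ∀ i, W i → Set Ordinal.{u}
  lambda_mono : ∀ i j, i < j → j < lam.ord → lambda_ i < lambda_ j
  lambda_regular : ∀ i, i < lam.ord → (lambda_ i).IsRegular
  lambda_lt : ∀ i, i < lam.ord → lambda_ i < μ
  lambda_cofinal : ∀ c, c < μ → ∃ i, i < lam.ord ∧ c ≤ lambda_ i
  D_uniform : ∀ i, i < lam.ord → IsUniformFilterOn (lambda_ i) (D i)
  g_pos : ∀ i, i < lam.ord → ∀ w : W i, g i w ∈ Pos (lambda_ i).ord (D i)
  g_mono : ∀ i, i < lam.ord → ∀ w u : W i, w ≤ u → g i u ⊆ g i w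
  g_deciding : ∀ i, i < lam.ord → ∀ A, A ⊆ Set.Iio (lambda_ i).ord → ∀ w : W i,
    ∃ u, w ≤ u ∧ (g i u ⊆ A ∨ g i u ⊆ Set.Iio (lambda_ i).ord \ A)

/-- A Sullam of length `θ` in `(∏_{i<lam} W i, D)`. -/
def IsSullam (lam θ : Cardinal.{u}) (W : Ordinal.{u} → Type v) [∀ i, Preorder (W i)]
    (D : Set (Set Ordinal.{u})) (f : Ordinal.{u} → ∀ i, W i) : Prop :=
  (∀ α β, α < β → β < θ.ord → {i | i < lam.ord ∧ f α i < f β i} ∈ D) ∧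
  (∀ V : ∀ i, Set (W i),
    (∀ i, i < lam.ord →
      (∀ w : W i, ∃ v ∈ V i, w ≤ v) ∧ (∀ v ∈ V i, ∀ u, v ≤ u → u ∈ V i)) →
    ∃ α, α < θ.ord ∧ {i | i < lam.ord ∧ f α i ∈ V i} ∈ D)

/-- The ultrafilter generated from a nice system, an ultrafilter `D` on `lam`
and a Sullam `f` of length `θ`:
`X ∈ U` iff `∃ α<θ` with `{i<lam : g i (f α i) ⊆_{D i} X ∩ λ_i} ∈ D`. -/
def genU (μ lam θ : Cardinal.{u}) {W : Ordinal.{u} → Type v} [∀ i, Preorder (W i)]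
    (S : NiceSystem μ lam W) (D : Set (Set Ordinal.{u}))
    (f : Ordinal.{u} → ∀ i, W i) : Set (Set Ordinal.{u}) :=
  {X | X ⊆ Set.Iio μ.ord ∧ ∃ α, α < θ.ord ∧
    {i | i < lam.ord ∧ SubMod (S.D i) (S.g i (f α i)) (X ∩ Set.Iio (S.lambda_ i).ord)} ∈ D}


/-- Enumerating a family of at most `c` sets by the ordinals below `c.ord`. -/
theorem exists_enum (c : Cardinal.{u}) (T : Set (Set Ordinal.{u})) (hT : T.Nonempty)
    (hc : #T ≤ Cardinal.lift.{u+1} c) :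
    ∃ b : Ordinal.{u} → Set Ordinal.{u}, (∀ α, b α ∈ T) ∧ ∀ A ∈ T, ∃ α, α < c.ord ∧ b α = A := by
  classical
  have h1 : #(Set.Iio c.ord) = Cardinal.lift.{u+1} c := by
    rw [Cardinal.mk_Iio_ordinal, card_ord]
  rw [← h1] at hc
  obtain ⟨e⟩ := hc
  have : Nonempty T := hT.to_subtype
  let e' : T → Ordinal.{u} := fun t => (e t : Ordinal.{u})
  have he' : Function.Injective e' := fun a b h => e.injective (Subtype.ext h)
  refine ⟨fun α => (Function.invFun e' α : T), fun α => (Function.invFun e' α).2, ?_⟩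
  intro A hA
  refine ⟨e' ⟨A, hA⟩, (e ⟨A, hA⟩).2, ?_⟩
  simp only [Function.leftInverse_invFun he' ⟨A, hA⟩]

theorem exists_base (lam : Cardinal.{u}) (D : Set (Set Ordinal.{u}))
    (hD : IsUniformUltrafilterOn lam D) : ∃ b, IsBaseFam lam D (Ch lam D) b := by
  have hne : {c | ∃ b, IsBaseFam lam D c b}.Nonempty := by
    obtain ⟨⟨⟨hsub, huniv, hemp, -, -⟩, -⟩, -⟩ := hD
    have hcard : #D ≤ Cardinal.lift.{u+1} (2 ^ lam) := by
      have h1 : #D ≤ #(𝒫 (Set.Iio lam.ord)) := mk_le_mk_of_subset hsub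
      rw [mk_powerset, Cardinal.mk_Iio_ordinal, card_ord] at h1
      simpa using h1
    obtain ⟨b, hb1, hb2⟩ := exists_enum _ D ⟨_, huniv⟩ hcard
    refine ⟨2 ^ lam, b, fun α _ => hb1 α, fun A hA => ?_⟩
    obtain ⟨α, h, rfl⟩ := hb2 A hA
    refine ⟨α, h, 0, ?_, by simp⟩
    rw [pos_iff_ne_zero]
    intro h0
    rw [h0] at huniv
    exact hemp (by simpa using huniv)
  exact csInf_mem hne

theorem tail_meets (lam : Cardinal.{u}) (D : Set (Set Ordinal.{u}))
    (hD : IsUniformUltrafilterOn lam D) (A : Set Ordinal.{u}) (hA : A ∈ D)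
    (j : Ordinal.{u}) (hj : j < lam.ord) : ∃ i ∈ A, j ≤ i := by
  by_contra! hcon
  have h1 := hD.2 A hA
  have h2 : #A ≤ #(Set.Iio j) := mk_le_mk_of_subset (fun x hx => hcon x hx)
  rw [h1, Cardinal.mk_Iio_ordinal, lift_le] at h2
  exact absurd (lt_ord.1 hj) (not_lt.2 h2)

section helpers

variable {μ lam θ : Cardinal.{u}} {W : Ordinal.{u} → Type v} [∀ i, Preorder (W i)]

theorem not_subMod_disj (S : NiceSystem μ lam W) (i : Ordinal.{u}) (hi : i < lam.ord) (w : W i)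
    (X : Set Ordinal.{u}) (h : SubMod (S.D i) (S.g i w) X)
    (h' : S.g i w ∩ X = ∅) : False := by
  obtain ⟨C, hC, hCX⟩ := h
  obtain ⟨hg1, hg2⟩ := S.g_pos i hi w
  obtain ⟨hs, -, -, -, hup⟩ := (S.D_uniform i hi).1
  refine hg2 (hup C hC _ sdiff_subset fun x hx => ⟨hs C hC hx, fun hxg => ?_⟩)
  have : x ∈ S.g i w ∩ X := ⟨hxg, hCX ⟨hxg, hx⟩⟩
  rw [h'] at this
  exact this

theorem subMod_card (S : NiceSystem μ lam W) (i : Ordinal.{u}) (hi : i < lam.ord) (w : W i)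
    (X : Set Ordinal.{u}) (h : SubMod (S.D i) (S.g i w) X) :
    Cardinal.lift.{u+1} (S.lambda_ i) ≤ #X := by
  by_contra! hlt
  obtain ⟨hf, hun⟩ := S.D_uniform i hi
  obtain ⟨hs, -, -, hint, hup⟩ := hf
  have hm : Set.Iio (S.lambda_ i).ord \ X ∈ S.D i := by
    refine hun _ sdiff_subset (lt_of_le_of_lt (mk_le_mk_of_subset ?_) hlt)
    intro x hx
    by_contra hxX
    exact hx.2 ⟨hx.1, hxX⟩
  obtain ⟨C, hC, hCX⟩ := h
  obtain ⟨hg1, hg2⟩ := S.g_pos i hi w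
  refine hg2 (hup _ (hint _ hm _ hC) _ sdiff_subset fun x hx => ⟨hs C hC hx.2, fun hxg => ?_⟩)
  exact hx.1.2 (hCX ⟨hxg, hx.2⟩)

/-- Deciding a set by the Sullam. -/
theorem sullam_decide (S : NiceSystem μ lam W) (D : Set (Set Ordinal.{u}))
    (hD : IsUniformUltrafilterOn lam D) (f : Ordinal.{u} → ∀ i, W i) (hf : IsSullam lam θ W D f)
    (X : Set Ordinal.{u}) : ∃ α, α < θ.ord ∧
      ({i | i < lam.ord ∧ S.g i (f α i) ⊆ X} ∈ D ∨
       {i | i < lam.ord ∧ S.g i (f α i) ∩ X = ∅} ∈ D) := by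
  obtain ⟨⟨⟨hs, huniv, hemp, hint, hup⟩, hult⟩, hcard⟩ := hD
  obtain ⟨α, hα, hV⟩ := hf.2 (fun i => {w | S.g i w ⊆ X ∨ S.g i w ∩ X = ∅}) (by
    intro i hi
    refine ⟨fun w => ?_, ?_⟩
    · obtain ⟨u, hu, h⟩ := S.g_deciding i hi (X ∩ Set.Iio (S.lambda_ i).ord) inter_subset_right w
      refine ⟨u, ?_, hu⟩
      rcases h with h | h
      · exact Or.inl (h.trans inter_subset_left)
      · refine Or.inr (eq_empty_of_forall_notMem fun x hx => ?_)
        exact (h hx.1).2 ⟨hx.2, (h hx.1).1⟩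
    · rintro v hv u hvu
      have := S.g_mono i hi v u hvu
      rcases hv with h | h
      · exact Or.inl (this.trans h)
      · exact Or.inr (subset_empty_iff.1 (h ▸ inter_subset_inter_left _ this)))
  refine ⟨α, hα, ?_⟩
  rcases hult {i | i < lam.ord ∧ S.g i (f α i) ⊆ X} (fun i hi => hi.1) with h | h
  · exact Or.inl h
  · refine Or.inr (hup _ (hint _ hV _ h) _ (fun i hi => hi.1) ?_)
    rintro i ⟨⟨hi, h1 | h1⟩, h2⟩
    · exact absurd ⟨hi, h1⟩ h2.2
    · exact ⟨hi, h1⟩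

theorem genU_mono (S : NiceSystem μ lam W) (D : Set (Set Ordinal.{u}))
    (hD : IsUniformUltrafilterOn lam D) (f : Ordinal.{u} → ∀ i, W i) (hf : IsSullam lam θ W D f)
    (X : Set Ordinal.{u}) (α β : Ordinal.{u}) (hαβ : α ≤ β) (hβ : β < θ.ord)
    (h : {i | i < lam.ord ∧
      SubMod (S.D i) (S.g i (f α i)) (X ∩ Set.Iio (S.lambda_ i).ord)} ∈ D) :
    {i | i < lam.ord ∧
      SubMod (S.D i) (S.g i (f β i)) (X ∩ Set.Iio (S.lambda_ i).ord)} ∈ D := by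
  rcases hαβ.eq_or_lt with rfl | hlt
  · exact h
  obtain ⟨⟨⟨hs, huniv, hemp, hint, hup⟩, hult⟩, hcard⟩ := hD
  refine hup _ (hint _ h _ (hf.1 α β hlt hβ)) _ (fun i hi => hi.1) ?_
  rintro i ⟨⟨hi, C, hC, h1⟩, _, h2⟩
  exact ⟨hi, C, hC, (inter_subset_inter_left _ (S.g_mono i hi _ _ h2.le)).trans h1⟩

/-- An exact inclusion gives an inclusion modulo the filter. -/
theorem subMod_of_subset (S : NiceSystem μ lam W) (i : Ordinal.{u}) (hi : i < lam.ord) (w : W i)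
    (X : Set Ordinal.{u}) (h : S.g i w ⊆ X) :
    SubMod (S.D i) (S.g i w) (X ∩ Set.Iio (S.lambda_ i).ord) :=
  ⟨_, (S.D_uniform i hi).1.2.1, fun _ hx => ⟨h hx.1, hx.2⟩⟩

theorem genU_ultra (hlam : ℵ₀ ≤ lam) (hθ : 0 < θ.ord)
    (S : NiceSystem μ lam W) (D : Set (Set Ordinal.{u}))
    (hD : IsUniformUltrafilterOn lam D) (f : Ordinal.{u} → ∀ i, W i)
    (hf : IsSullam lam θ W D f) : IsUniformUltrafilterOn μ (genU μ lam θ S D f) := by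
  obtain ⟨⟨⟨hs, huniv, hemp, hint, hup⟩, hult⟩, hcard⟩ := id hD
  have hlt : ∀ i, i < lam.ord → ∀ w, S.g i w ⊆ Set.Iio μ.ord := fun i hi w x hx =>
    lt_trans ((S.g_pos i hi w).1 hx) (ord_lt_ord.2 (S.lambda_lt i hi))
  refine ⟨⟨⟨fun A hA => hA.1, ?_, ?_, ?_, ?_⟩, ?_⟩, ?_⟩
  · refine ⟨subset_rfl, 0, hθ, hup _ huniv _ (fun i hi => hi.1) fun i hi => ⟨hi, ?_⟩⟩
    exact subMod_of_subset S i hi _ _ (hlt i hi _)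
  · rintro ⟨-, α, -, h⟩
    obtain ⟨i, hi⟩ : ({i | i < lam.ord ∧ SubMod (S.D i) (S.g i (f α i))
        (∅ ∩ Set.Iio (S.lambda_ i).ord)} : Set Ordinal.{u}).Nonempty := by
      rw [nonempty_iff_ne_empty]
      intro h0
      exact hemp (h0 ▸ h)
    exact not_subMod_disj S i hi.1 _ _ hi.2 (by simp)
  · rintro A ⟨hA, α, hα, h1⟩ B ⟨hB, β, hβ, h2⟩
    refine ⟨inter_subset_left.trans hA, max α β, max_lt hα hβ, ?_⟩
    have k1 := genU_mono S D hD f hf A α _ (le_max_left α β) (max_lt hα hβ) h1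
    have k2 := genU_mono S D hD f hf B β _ (le_max_right α β) (max_lt hα hβ) h2
    refine hup _ (hint _ k1 _ k2) _ (fun i hi => hi.1) ?_
    rintro i ⟨⟨hi, C, hC, h3⟩, _, E, hE, h4⟩
    refine ⟨hi, C ∩ E, (S.D_uniform i hi).1.2.2.2.1 _ hC _ hE, ?_⟩
    rintro x ⟨hx, hxC, hxE⟩
    exact ⟨⟨(h3 ⟨hx, hxC⟩).1, (h4 ⟨hx, hxE⟩).1⟩, (h3 ⟨hx, hxC⟩).2⟩
  · rintro A ⟨hA, α, hα, h1⟩ B hB hAB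
    refine ⟨hB, α, hα, hup _ h1 _ (fun i hi => hi.1) ?_⟩
    rintro i ⟨hi, C, hC, h3⟩
    exact ⟨hi, C, hC, h3.trans (inter_subset_inter_left _ hAB)⟩
  · intro X hX
    obtain ⟨α, hα, h | h⟩ := sullam_decide S D hD f hf X
    · refine Or.inl ⟨hX, α, hα, hup _ h _ (fun i hi => hi.1) ?_⟩
      rintro i ⟨hi, h1⟩
      exact ⟨hi, subMod_of_subset S i hi _ _ h1⟩
    · refine Or.inr ⟨sdiff_subset, α, hα, hup _ h _ (fun i hi => hi.1) ?_⟩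
      rintro i ⟨hi, h1⟩
      refine ⟨hi, subMod_of_subset S i hi _ _ fun x hx => ⟨hlt i hi _ hx, fun hxX => ?_⟩⟩
      have : x ∈ S.g i (f α i) ∩ X := ⟨hx, hxX⟩
      rw [h1] at this
      exact this
  · rintro X ⟨hX, α, hα, h⟩
    apply le_antisymm
    · have h2 := mk_le_mk_of_subset hX
      rwa [Cardinal.mk_Iio_ordinal, card_ord] at h2
    · by_contra! hlt'
      obtain ⟨c, hc⟩ := Cardinal.mem_range_lift_of_le hlt'.le
      rw [← hc, lift_lt] at hlt'
      obtain ⟨j, hj, hcj⟩ := S.lambda_cofinal c hlt'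
      have hj1 : Order.succ j < lam.ord := (isSuccLimit_ord hlam).succ_lt hj
      obtain ⟨i, hiA, hji⟩ := tail_meets lam D hD _ h _ hj1
      have h1 := (subMod_card S i hiA.1 _ _ hiA.2).trans (mk_le_mk_of_subset inter_subset_left)
      rw [← hc, lift_le] at h1
      exact absurd (h1.trans hcj)
        (not_le.2 (S.lambda_mono j i (lt_of_lt_of_le (Order.lt_succ j) hji) hiA.1))

theorem genU_base (hlam : ℵ₀ ≤ lam) (hθ : ℵ₀ ≤ θ)
    (S : NiceSystem μ lam W) (D : Set (Set Ordinal.{u}))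
    (hD : IsUniformUltrafilterOn lam D) (hCh : Ch lam D ≤ θ) (f : Ordinal.{u} → ∀ i, W i)
    (hf : IsSullam lam θ W D f) : ∃ b, IsBaseFam μ (genU μ lam θ S D f) θ b := by
  obtain ⟨d, hd1, hd2⟩ := exists_base lam D hD
  obtain ⟨⟨⟨hs, huniv, hemp, hint, hup⟩, hult⟩, hcard⟩ := id hD
  have hlt : ∀ i, i < lam.ord → ∀ w, S.g i w ⊆ Set.Iio μ.ord := fun i hi w x hx =>
    lt_trans ((S.g_pos i hi w).1 hx) (ord_lt_ord.2 (S.lambda_lt i hi))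
  let B : Set.Iio θ.ord × Set.Iio (Ch lam D).ord → Set Ordinal.{u} :=
    fun p => {x | ∃ i ∈ d p.2, x ∈ S.g i (f p.1 i)}
  have hBU : ∀ p, B p ∈ genU μ lam θ S D f := by
    rintro ⟨⟨α, hα⟩, ⟨γ, hγ⟩⟩
    have hdD := hd1 γ hγ
    refine ⟨?_, α, hα, hup _ hdD _ (fun i hi => hi.1) fun i hi => ?_⟩
    · rintro x ⟨i, hi, hx⟩
      exact hlt i (hs _ hdD hi) _ hx
    · exact ⟨hs _ hdD hi, subMod_of_subset S i (hs _ hdD hi) _ _ fun x hx => ⟨i, hi, hx⟩⟩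
  have hθ0 : 0 < θ.ord := by
    rw [lt_ord]; simpa using lt_of_lt_of_le aleph0_pos hθ
  obtain ⟨γ0, hγ0, -⟩ := hd2 _ huniv
  have hcB : #(Set.range B) ≤ Cardinal.lift.{u+1} θ := by
    refine mk_range_le.trans ?_
    rw [mk_prod, Cardinal.lift_id, Cardinal.lift_id, Cardinal.mk_Iio_ordinal,
      Cardinal.mk_Iio_ordinal, card_ord, card_ord, ← lift_mul, lift_le]
    exact (mul_le_mul_right hCh θ).trans (mul_eq_self hθ).le
  obtain ⟨b, hb1, hb2⟩ := exists_enum θ (Set.range B) ⟨_, ⟨⟨0, hθ0⟩, ⟨γ0, hγ0⟩⟩, rfl⟩ hcB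
  refine ⟨b, fun α _ => ?_, ?_⟩
  · obtain ⟨p, hp⟩ := hb1 α
    rw [← hp]
    exact hBU p
  · rintro X hX
    have hXU := genU_ultra hlam hθ0 S D hD f hf
    obtain ⟨α, hα, h⟩ := sullam_decide S D hD f hf X
    have hA : {i | i < lam.ord ∧ S.g i (f α i) ⊆ X} ∈ D := by
      rcases h with h | h
      · exact h
      exfalso
      have h1 : Set.Iio μ.ord \ X ∈ genU μ lam θ S D f := by
        refine ⟨sdiff_subset, α, hα, hup _ h _ (fun i hi => hi.1) ?_⟩
        rintro i ⟨hi, h1⟩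
        refine ⟨hi, subMod_of_subset S i hi _ _ fun x hx => ⟨hlt i hi _ hx, fun hxX => ?_⟩⟩
        have : x ∈ S.g i (f α i) ∩ X := ⟨hx, hxX⟩
        rw [h1] at this
        exact this
      have h2 := hXU.1.1.2.2.2.1 _ hX _ h1
      rw [inter_sdiff_self] at h2
      exact hXU.1.1.2.2.1 h2
    obtain ⟨γ, hγ, β, hβ, hbd⟩ := hd2 _ hA
    obtain ⟨ξ, hξ, hbξ⟩ := hb2 _ ⟨(⟨⟨α, hα⟩, ⟨γ, hγ⟩⟩ : Set.Iio θ.ord × Set.Iio (Ch lam D).ord), rfl⟩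
    refine ⟨ξ, hξ, (S.lambda_ β).ord, ord_lt_ord.2 (S.lambda_lt β hβ), ?_⟩
    rw [hbξ]
    rintro x ⟨⟨i, hi, hx⟩, hxX⟩
    have hil := hs _ (hd1 γ hγ) hi
    have hiβ : i < β := by
      refine hbd ⟨hi, fun hi' => hxX (hi'.2 hx)⟩
    exact lt_trans ((S.g_pos i hil _).1 hx) (ord_lt_ord.2 (S.lambda_mono i β hiβ hβ))

end helpers

/-- If `μ` is singular with `lam = cf μ < μ`, `S` is a nice system for `μ`,
`D` is a uniform ultrafilter on `lam`, `θ` is regular with `μ < θ ≤ 2^μ`, `Ch(D) ≤ θ`, and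
there is a Sullam of length `θ` in `(∏ W i, D)`, then there is a uniform ultrafilter `U`
on `μ` with `Ch(U) ≤ θ`; in particular `𝔲_μ ≤ θ`. -/
theorem statement0 (μ lam θ : Cardinal.{u}) (W : Ordinal.{u} → Type v) [∀ i, Preorder (W i)]
    (hμinf : ℵ₀ ≤ μ) (hlam : lam = μ.ord.cof) (hsing : lam < μ)
    (S : NiceSystem μ lam W)
    (D : Set (Set Ordinal.{u})) (hD : IsUniformUltrafilterOn lam D)
    (hθreg : θ.IsRegular) (hθ1 : μ < θ) (hθ2 : θ ≤ 2 ^ μ)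
    (hChD : Ch lam D ≤ θ)
    (f : Ordinal.{u} → ∀ i, W i) (hf : IsSullam lam θ W D f) :
    (∃ U, IsUniformUltrafilterOn μ U ∧ Ch μ U ≤ θ) ∧ uNumber μ ≤ θ := by
  have hlω : ℵ₀ ≤ lam := by
    rw [hlam]
    exact Ordinal.aleph0_le_cof.2 (isSuccLimit_ord hμinf)
  have hθ0 : 0 < θ.ord := by
    rw [lt_ord]; simpa using lt_of_lt_of_le aleph0_pos hθreg.aleph0_le
  have hU := genU_ultra hlω hθ0 S D hD f hf
  have hCh : Ch μ (genU μ lam θ S D f) ≤ θ :=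
    csInf_le' (genU_base hlω hθreg.aleph0_le S D hD hChD f hf)
  exact ⟨⟨_, hU, hCh⟩, (csInf_le' ⟨_, hU, rfl⟩ : uNumber μ ≤ _).trans hCh⟩
end PaperUlt
end

section
/- Let μ be a singular cardinal with λ = cf(μ) < μ, let S be a nice system for μ, let D be a uniform ultrafilter on λ, let θ > μ be a cardinal, and let ⟨f_α : α<θ⟩ be a Sullam in (∏_{i<λ} W_i, D). Define U = {X ⊆ μ : ∃α<θ such that {i<λ : g_i(f_α(i)) ⊆_{D_i} X∩λ_i} ∈ D}. Then U is a proper filter on μ: μ ∈ U, ∅ ∉ U, U is closed under binary intersections, and U is closed under supersets. -/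
universe u v

namespace PaperUlt

open Cardinal Set

/-- With `μ` singular, `lam = cf μ < μ`, a nice system `S`, a uniform
ultrafilter `D` on `lam`, a cardinal `θ > μ` and a Sullam `f` of length `θ`, the family
`U = {X ⊆ μ : ∃ α<θ, {i<lam : g i (f α i) ⊆_{D i} X ∩ λ_i} ∈ D}` is a proper filter on `μ`:
`μ ∈ U`, `∅ ∉ U`, `U` is closed under binary intersections, and under supersets. -/
theorem statement1 (μ lam θ : Cardinal.{u}) (W : Ordinal.{u} → Type v) [∀ i, Preorder (W i)]
    (hμinf : ℵ₀ ≤ μ) (hlam : lam = μ.ord.cof) (hsing : lam < μ)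
    (S : NiceSystem μ lam W)
    (D : Set (Set Ordinal.{u})) (hD : IsUniformUltrafilterOn lam D)
    (hθ : μ < θ)
    (f : Ordinal.{u} → ∀ i, W i) (hf : IsSullam lam θ W D f) :
    Set.Iio μ.ord ∈ genU μ lam θ S D f ∧
    (∅ : Set Ordinal.{u}) ∉ genU μ lam θ S D f ∧
    (∀ X ∈ genU μ lam θ S D f, ∀ Y ∈ genU μ lam θ S D f,
      X ∩ Y ∈ genU μ lam θ S D f) ∧
    (∀ X ∈ genU μ lam θ S D f, ∀ Y, Y ⊆ Set.Iio μ.ord → X ⊆ Y →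
      Y ∈ genU μ lam θ S D f) := by
  obtain ⟨⟨⟨hDsub, hDtop, hDbot, hDint, hDsup⟩, -⟩, -⟩ := hD
  have up : ∀ X α β, α ≤ β → β < θ.ord →
      {i | i < lam.ord ∧ SubMod (S.D i) (S.g i (f α i)) (X ∩ Set.Iio (S.lambda_ i).ord)} ∈ D →
      {i | i < lam.ord ∧ SubMod (S.D i) (S.g i (f β i)) (X ∩ Set.Iio (S.lambda_ i).ord)} ∈ D := by
    intro X α β hαβ hβ h
    rcases hαβ.eq_or_lt with rfl | hlt
    · exact h
    · refine hDsup _ (hDint _ h _ (hf.1 α β hlt hβ)) _ (fun i hi => hi.1) ?_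
      rintro i ⟨⟨hi, C, hC, hsub⟩, -, hlt'⟩
      exact ⟨hi, C, hC, fun x hx => hsub ⟨S.g_mono i hi _ _ hlt'.le hx.1, hx.2⟩⟩
  refine ⟨⟨subset_rfl, 0, ?_, ?_⟩, ?_, ?_, ?_⟩
  · rw [Cardinal.lt_ord, Ordinal.card_zero]
    exact lt_of_le_of_lt zero_le hθ
  · refine hDsup _ hDtop _ (fun i hi => hi.1) ?_
    intro i hi
    refine ⟨hi, _, (S.D_uniform i hi).1.2.1, ?_⟩
    rintro x ⟨-, hx⟩
    exact ⟨lt_of_lt_of_le hx (Cardinal.ord_le_ord.2 (S.lambda_lt i hi).le), hx⟩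
  · rintro ⟨-, α, -, h⟩
    refine hDbot ?_
    convert h
    symm
    rw [Set.eq_empty_iff_forall_notMem]
    rintro i ⟨hi, C, hC, hsub⟩
    have hF := (S.D_uniform i hi).1
    refine (S.g_pos i hi (f α i)).2 (hF.2.2.2.2 C hC _ (fun x hx => hx.1) ?_)
    exact fun x hx => ⟨hF.1 C hC hx, fun hg => (hsub ⟨hg, hx⟩).1⟩
  · rintro X ⟨hX, α, hα, hXα⟩ Y ⟨hY, β, hβ, hYβ⟩
    have hm : max α β < θ.ord := max_lt hα hβ
    refine ⟨fun x hx => hX hx.1, max α β, hm, ?_⟩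
    refine hDsup _ (hDint _ (up X _ _ (le_max_left α β) hm hXα) _
      (up Y _ _ (le_max_right α β) hm hYβ)) _ (fun i hi => hi.1) ?_
    rintro i ⟨⟨hi, C, hC, hCs⟩, -, E, hE, hEs⟩
    refine ⟨hi, C ∩ E, (S.D_uniform i hi).1.2.2.2.1 C hC E hE, ?_⟩
    intro x hx
    have h1 := hCs ⟨hx.1, hx.2.1⟩
    have h2 := hEs ⟨hx.1, hx.2.2⟩
    exact ⟨⟨h1.1, h2.1⟩, h1.2⟩
  · rintro X ⟨-, α, hα, hXα⟩ Y hY hXY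
    refine ⟨hY, α, hα, hDsup _ hXα _ (fun i hi => hi.1) ?_⟩
    rintro i ⟨hi, C, hC, hCs⟩
    exact ⟨hi, C, hC, fun x hx => ⟨hXY (hCs hx).1, (hCs hx).2⟩⟩
end PaperUlt
end

section
/- Let μ be a singular cardinal with λ = cf(μ) < μ, let S be a nice system for μ, let D be a uniform ultrafilter on λ, let θ > μ be a cardinal, and let ⟨f_α : α<θ⟩ be a Sullam in (∏_{i<λ} W_i, D). Define U = {X ⊆ μ : ∃α<θ such that {i<λ : g_i(f_α(i)) ⊆_{D_i} X∩λ_i} ∈ D}. Then U decides every subset of μ: for every X ⊆ μ, either X ∈ U or μ∖X ∈ U. -/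
universe u v

namespace PaperUlt

open Cardinal Set

/-- With the same setup, the family
`U = {X ⊆ μ : ∃ α<θ, {i<lam : g i (f α i) ⊆_{D i} X ∩ λ_i} ∈ D}` decides every subset
of `μ`: for every `X ⊆ μ`, either `X ∈ U` or `μ ∖ X ∈ U`. -/
theorem statement2 (μ lam θ : Cardinal.{u}) (W : Ordinal.{u} → Type v) [∀ i, Preorder (W i)]
    (hμinf : ℵ₀ ≤ μ) (hlam : lam = μ.ord.cof) (hsing : lam < μ)
    (S : NiceSystem μ lam W)
    (D : Set (Set Ordinal.{u})) (hD : IsUniformUltrafilterOn lam D)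
    (hθ : μ < θ)
    (f : Ordinal.{u} → ∀ i, W i) (hf : IsSullam lam θ W D f) :
    ∀ X, X ⊆ Set.Iio μ.ord →
      (X ∈ genU μ lam θ S D f ∨ (Set.Iio μ.ord \ X) ∈ genU μ lam θ S D f) := by
  intro X hX
  obtain ⟨α, hα, hV⟩ := hf.2
    (fun i => {w | S.g i w ⊆ X ∩ Set.Iio (S.lambda_ i).ord ∨
      S.g i w ⊆ Set.Iio (S.lambda_ i).ord \ (X ∩ Set.Iio (S.lambda_ i).ord)}) (by
    intro i hi
    constructor
    · intro w
      obtain ⟨u, hu, h⟩ := S.g_deciding i hi (X ∩ Set.Iio (S.lambda_ i).ord)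
        Set.inter_subset_right w
      exact ⟨u, h, hu⟩
    · intro v hv u hvu
      have hm := S.g_mono i hi v u hvu
      exact hv.imp (fun h => hm.trans h) (fun h => hm.trans h))
  obtain ⟨⟨⟨_, _, _, hinter, hup⟩, hult⟩, _⟩ := hD
  have hmod : ∀ i, i < lam.ord → ∀ A B : Set Ordinal.{u}, A ⊆ B → SubMod (S.D i) A B :=
    fun i hi A B h => ⟨_, (S.D_uniform i hi).1.2.1, Set.inter_subset_left.trans h⟩
  rcases hult {i | i < lam.ord ∧ S.g i (f α i) ⊆ X ∩ Set.Iio (S.lambda_ i).ord}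
    (fun i hi => hi.1) with h | h
  · left
    refine ⟨hX, α, hα, hup _ h _ (fun i hi => hi.1) ?_⟩
    rintro i ⟨hi, h1⟩
    exact ⟨hi, hmod i hi _ _ h1⟩
  · right
    refine ⟨Set.diff_subset, α, hα, hup _ (hinter _ h _ hV) _ (fun i hi => hi.1) ?_⟩
    rintro i ⟨⟨hi, h1⟩, _, h2⟩
    refine ⟨hi, hmod i hi _ _ ?_⟩
    rcases h2 with h2 | h2
    · exact absurd ⟨hi, h2⟩ h1
    · intro x hx
      obtain ⟨hx1, hx2⟩ := h2 hx
      exact ⟨⟨lt_of_lt_of_le hx1 (Cardinal.ord_le_ord.2 (S.lambda_lt i hi).le),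
        fun hxX => hx2 ⟨hxX, hx1⟩⟩, hx1⟩
end PaperUlt
end

section
/- Let μ be a singular cardinal with λ = cf(μ) < μ, let S be a nice system for μ, let D be a uniform ultrafilter on λ, let θ > μ be a cardinal, and let ⟨f_α : α<θ⟩ be a Sullam in (∏_{i<λ} W_i, D). Define U = {X ⊆ μ : ∃α<θ such that {i<λ : g_i(f_α(i)) ⊆_{D_i} X∩λ_i} ∈ D}. Then U is uniform: every X ∈ U has cardinality μ. -/
universe u v

namespace PaperUlt

open Cardinal Set

/-- With the same setup, the family
`U = {X ⊆ μ : ∃ α<θ, {i<lam : g i (f α i) ⊆_{D i} X ∩ λ_i} ∈ D}` is uniform: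
every `X ∈ U` has cardinality `μ`. -/
theorem statement3 (μ lam θ : Cardinal.{u}) (W : Ordinal.{u} → Type v) [∀ i, Preorder (W i)]
    (hμinf : ℵ₀ ≤ μ) (hlam : lam = μ.ord.cof) (hsing : lam < μ)
    (S : NiceSystem μ lam W)
    (D : Set (Set Ordinal.{u})) (hD : IsUniformUltrafilterOn lam D)
    (hθ : μ < θ)
    (f : Ordinal.{u} → ∀ i, W i) (hf : IsSullam lam θ W D f) :
    ∀ X ∈ genU μ lam θ S D f, #↥X = Cardinal.lift.{u+1} μ := by
  rintro X ⟨hXμ, α, hα, hA⟩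
  have card_le : ∀ i, i < lam.ord →
      SubMod (S.D i) (S.g i (f α i)) (X ∩ Set.Iio (S.lambda_ i).ord) →
      Cardinal.lift.{u+1} (S.lambda_ i) ≤ #↥X := by
    rintro i hi ⟨C, hC, hsub⟩
    by_contra hlt
    rw [not_le] at hlt
    obtain ⟨⟨hF1, hF2, hF3, hF4, hF5⟩, hU⟩ := S.D_uniform i hi
    obtain ⟨hg1, hg2⟩ := S.g_pos i hi (f α i)
    apply hg2
    have h1 : Set.Iio (S.lambda_ i).ord \ (S.g i (f α i) ∩ C) ∈ S.D i := by
      apply hU _ Set.sdiff_subset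
      refine lt_of_le_of_lt (Cardinal.mk_le_mk_of_subset ?_) hlt
      intro x hx
      have hx2 : x ∈ S.g i (f α i) ∩ C := by
        by_contra hn
        exact hx.2 ⟨hx.1, hn⟩
      exact (hsub hx2).1
    refine hF5 _ (hF4 _ hC _ h1) _ Set.sdiff_subset ?_
    rintro x ⟨hxC, hx1, hx2⟩
    exact ⟨hx1, fun hg => hx2 ⟨hg, hxC⟩⟩
  have hup : #↥X ≤ Cardinal.lift.{u+1} μ := by
    refine (Cardinal.mk_le_mk_of_subset hXμ).trans ?_
    simp [Cardinal.mk_Iio_ordinal]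
  refine le_antisymm hup ?_
  by_contra hlt
  rw [not_le] at hlt
  obtain ⟨c, hc⟩ := Cardinal.mem_range_lift_of_le hlt.le
  rw [← hc, Cardinal.lift_lt] at hlt
  obtain ⟨i, hi, hci⟩ := S.lambda_cofinal c hlt
  have hinf : ℵ₀ ≤ lam := by
    rw [hlam, Ordinal.aleph0_le_cof_iff, Ordinal.one_lt_cof_iff]
    exact Cardinal.isSuccLimit_ord hμinf
  have hsucc : Order.succ i < lam.ord := (Cardinal.isSuccLimit_ord hinf).succ_lt hi
  have hex : ∃ j, (j < lam.ord ∧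
      SubMod (S.D j) (S.g j (f α j)) (X ∩ Set.Iio (S.lambda_ j).ord)) ∧ i < j := by
    by_contra hn
    push Not at hn
    have h2 := hD.2 _ hA
    have h3 := Cardinal.mk_le_mk_of_subset
      (show {i | i < lam.ord ∧ SubMod (S.D i) (S.g i (f α i)) (X ∩ Set.Iio (S.lambda_ i).ord)} ⊆
        Set.Iio (Order.succ i) from fun j hj => Order.lt_succ_of_le (hn j hj))
    rw [h2, Cardinal.mk_Iio_ordinal, Cardinal.lift_le] at h3
    exact absurd (Cardinal.lt_ord.1 hsucc) (not_lt.2 h3)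
  obtain ⟨j, ⟨hj, hjs⟩, hij⟩ := hex
  have h4 := card_le j hj hjs
  rw [← hc, Cardinal.lift_le] at h4
  exact absurd (hci.trans_lt (S.lambda_mono i j hij hj)) (not_lt.2 h4)
end PaperUlt
end

section
/- Let μ be a singular cardinal with λ = cf(μ) < μ, let S be a nice system for μ, let D be a uniform ultrafilter on λ, let θ > μ be a cardinal, let ⟨f_β : β<θ⟩ be a Sullam in (∏_{i<λ} W_i, D), and let ⟨d_α : α<θ⟩ be a base for D (for every Y ∈ D there is α with d_α∖Y bounded in λ). Define U = {X ⊆ μ : ∃α<θ such that {i<λ : g_i(f_α(i)) ⊆_{D_i} X∩λ_i} ∈ D}, and for α,β<θ define B_{α,β} = ⋃_{i∈d_α} g_i(f_β(i)). Then each B_{α,β} ∈ U, and {B_{α,β} : α,β<θ} is a base for U: for every X ∈ U there are α,β<θ such that B_{α,β}∖X is bounded in μ. Consequently Ch(U) ≤ θ. -/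
universe u v

namespace PaperUlt

open Cardinal Set

/-- With the same setup, if moreover `⟨d α : α < θ⟩` is a base for `D`
(each `d α ∈ D`, and every `Y ∈ D` almost contains some `d α`), then setting
`B α β = ⋃_{i ∈ d α} g i (f β i)`, each `B α β` belongs to
`U = {X ⊆ μ : ∃ α<θ, {i<lam : g i (f α i) ⊆_{D i} X ∩ λ_i} ∈ D}`, and
`{B α β : α,β < θ}` is a base for `U`: every `X ∈ U` admits `α,β < θ` with `B α β ∖ X`
bounded in `μ`. Consequently `Ch(U) ≤ θ`. -/
theorem statement4 (μ lam θ : Cardinal.{u}) (W : Ordinal.{u} → Type v) [∀ i, Preorder (W i)]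
    (hμinf : ℵ₀ ≤ μ) (hlam : lam = μ.ord.cof) (hsing : lam < μ)
    (S : NiceSystem μ lam W)
    (D : Set (Set Ordinal.{u})) (hD : IsUniformUltrafilterOn lam D)
    (hθ : μ < θ)
    (f : Ordinal.{u} → ∀ i, W i) (hf : IsSullam lam θ W D f)
    (d : Ordinal.{u} → Set Ordinal.{u})
    (hd_mem : ∀ α, α < θ.ord → d α ∈ D)
    (hd_base : ∀ Y ∈ D, ∃ α, α < θ.ord ∧ BoundedIn lam.ord (d α \ Y)) :
    (∀ α β, α < θ.ord → β < θ.ord →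
      (⋃ i ∈ d α, S.g i (f β i)) ∈ genU μ lam θ S D f) ∧
    (∀ X ∈ genU μ lam θ S D f, ∃ α β, α < θ.ord ∧ β < θ.ord ∧
      BoundedIn μ.ord ((⋃ i ∈ d α, S.g i (f β i)) \ X)) ∧
    Ch μ (genU μ lam θ S D f) ≤ θ := by
  obtain ⟨⟨⟨hDsub, hDtop, hDne, hDinter, hDup⟩, -⟩, -⟩ := hD
  have h1 : ∀ α β, α < θ.ord → β < θ.ord →
      (⋃ i ∈ d α, S.g i (f β i)) ∈ genU μ lam θ S D f := by
    intro α β hα hβ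
    have hsub := hDsub _ (hd_mem α hα)
    refine ⟨?_, β, hβ, ?_⟩
    · intro x hx
      simp only [Set.mem_iUnion] at hx
      obtain ⟨i, hi, hx⟩ := hx
      have hil : i < lam.ord := hsub hi
      have hx' := (S.g_pos i hil (f β i)).1 hx
      exact lt_trans hx' (Cardinal.ord_lt_ord.2 (S.lambda_lt i hil))
    · refine hDup _ (hd_mem α hα) _ (fun i hi => hi.1) ?_
      intro i hi
      have hil : i < lam.ord := hsub hi
      refine ⟨hil, Set.Iio (S.lambda_ i).ord, (S.D_uniform i hil).1.2.1, ?_⟩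
      rintro x ⟨hx, hx'⟩
      refine ⟨?_, hx'⟩
      simp only [Set.mem_iUnion]
      exact ⟨i, hi, hx⟩
  have h2 : ∀ X ∈ genU μ lam θ S D f, ∃ α β, α < θ.ord ∧ β < θ.ord ∧
      BoundedIn μ.ord ((⋃ i ∈ d α, S.g i (f β i)) \ X) := by
    rintro X ⟨hXμ, α, hα, hY⟩
    obtain ⟨β, hβ, hV⟩ := hf.2
      (fun i => {w | S.g i w ⊆ X ∩ Set.Iio (S.lambda_ i).ord ∨
        S.g i w ⊆ Set.Iio (S.lambda_ i).ord \ (X ∩ Set.Iio (S.lambda_ i).ord)}) (by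
      intro i hi
      refine ⟨fun w => ?_, fun v hv u hvu => ?_⟩
      · obtain ⟨u, hu, h⟩ := S.g_deciding i hi (X ∩ Set.Iio (S.lambda_ i).ord)
          Set.inter_subset_right w
        exact ⟨u, h, hu⟩
      · have hm := S.g_mono i hi v u hvu
        exact hv.imp (fun h => hm.trans h) (fun h => hm.trans h))
    have hle : ∀ a b, a ≤ b → b < θ.ord → {i | i < lam.ord ∧ f a i ≤ f b i} ∈ D := by
      intro a b hab hb
      rcases hab.eq_or_lt with rfl | hab
      · exact hDup _ hDtop _ (fun i hi => hi.1) (fun i hi => ⟨hi, le_rfl⟩)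
      · exact hDup _ (hf.1 a b hab hb) _ (fun i hi => hi.1) (fun i hi => ⟨hi.1, hi.2.le⟩)
    have hγ : max α β < θ.ord := max_lt hα hβ
    have hZ : {i | i < lam.ord ∧ S.g i (f (max α β) i) ⊆ X} ∈ D := by
      refine hDup _ (hDinter _ (hDinter _ hY _ hV) _
        (hDinter _ (hle α _ (le_max_left α β) hγ) _ (hle β _ (le_max_right α β) hγ))) _
        (fun i hi => hi.1) ?_
      rintro i ⟨⟨⟨hi, C, hC, hCs⟩, -, hVi⟩, ⟨-, hai⟩, -, hbi⟩
      refine ⟨hi, ?_⟩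
      have hma := S.g_mono i hi _ _ hai
      have hmb := S.g_mono i hi _ _ hbi
      rcases hVi with h | h
      · exact (hmb.trans h).trans Set.inter_subset_left
      · exfalso
        apply (S.g_pos i hi (f (max α β) i)).2
        have hF := (S.D_uniform i hi).1
        refine hF.2.2.2.2 C hC _ Set.sdiff_subset ?_
        intro x hx
        refine ⟨hF.1 C hC hx, fun hxg => ?_⟩
        exact (h (hmb hxg)).2 (hCs ⟨hma hxg, hx⟩)
    obtain ⟨δ, hδ, ε, hε, hb⟩ := hd_base _ hZ
    refine ⟨δ, max α β, hδ, hγ, (S.lambda_ ε).ord, Cardinal.ord_lt_ord.2 (S.lambda_lt ε hε), ?_⟩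
    rintro x ⟨hx, hxX⟩
    simp only [Set.mem_iUnion] at hx
    obtain ⟨i, hi, hx⟩ := hx
    have hil : i < lam.ord := hDsub _ (hd_mem δ hδ) hi
    have hiε : i < ε := hb ⟨hi, fun h => hxX (h.2 hx)⟩
    exact lt_trans ((S.g_pos i hil _).1 hx) (Cardinal.ord_lt_ord.2 (S.lambda_mono i ε hiε hε))
  refine ⟨h1, h2, csInf_le' ?_⟩
  have hθinf : ℵ₀ ≤ θ := hμinf.trans hθ.le
  have hcard : #(Set.Iio θ.ord) = #(Set.Iio θ.ord × Set.Iio θ.ord) := by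
    have h : #(Set.Iio θ.ord) = Cardinal.lift.{u+1} θ := by
      rw [Cardinal.mk_Iio_ordinal, Cardinal.card_ord]
    rw [Cardinal.mk_prod, Cardinal.lift_id, Cardinal.mul_eq_self]
    rw [h]
    simpa using hθinf
  obtain ⟨e⟩ := Cardinal.eq.1 hcard
  classical
  refine ⟨fun a => if h : a < θ.ord then
    ⋃ i ∈ d (e ⟨a, h⟩).1, S.g i (f (e ⟨a, h⟩).2 i) else ∅, ?_, ?_⟩
  · intro a ha
    simp only [dif_pos ha]
    exact h1 _ _ (e ⟨a, ha⟩).1.2 (e ⟨a, ha⟩).2.2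
  · intro X hX
    obtain ⟨α, β, hα, hβ, h⟩ := h2 X hX
    have ha := (e.symm (⟨α, hα⟩, ⟨β, hβ⟩)).2
    refine ⟨(e.symm (⟨α, hα⟩, ⟨β, hβ⟩)).1, ha, ?_⟩
    have ha' : (e.symm (⟨α, hα⟩, ⟨β, hβ⟩)).1 < θ.ord := ha
    have he : e ⟨(e.symm (⟨α, hα⟩, ⟨β, hβ⟩)).1, ha'⟩ = (⟨α, hα⟩, ⟨β, hβ⟩) :=
      e.apply_symm_apply _
    simp only [dif_pos ha']
    rw [he]
    exact h
end PaperUlt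
end
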